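/- Each of the endomorphisms ν_{i0}, ν_{j0}, and ν_s (s ∈ S) of 𝒟 is bijective, i.e. a k-algebra automorphism of 𝒟. -/

import Mathlib

/-!
The diffusion algebra of type `B` on `N` generators over a field `k`, with
`I = {i0, j0}` (where `i0 < j0`) and `S = {1,…,N} \ {i0, j0}`, and common
coefficient `G` (denoted `𝒢` in the paper).  It is the quotient of the free
associative unital `k`-algebra on generators `D_1, …, D_N` by the two-sided
ideal generated by
`g·D_{i0}·D_{j0} − (g − Λ)·D_{j0}·D_{i0} − x_{j0}·D_{i0} + x_{i0}·D_{j0}`,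
`G·D_{i0}·D_s − (G − Λ)·D_s·D_{i0} + x_{i0}·D_s` for `s ∈ S`,
`G·D_s·D_{j0} − (G − Λ)·D_{j0}·D_s − x_{j0}·D_s` for `s ∈ S`, and
`D_s·D_l − D_l·D_s` for `s, l ∈ S`.
-/

noncomputable section

namespace DiffusionB

open FreeAlgebra

variable (k : Type*) [Field k] (N : ℕ) (i0 j0 : Fin N) (g Λ xi xj G : k)

/-- The defining relations of the type `B` diffusion algebra. -/
def rel : FreeAlgebra k (Fin N) → FreeAlgebra k (Fin N) → Prop := fun a b =>
  (a = g • (ι k i0 * ι k j0) ∧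
   b = (g - Λ) • (ι k j0 * ι k i0) + xj • ι k i0 - xi • ι k j0) ∨
  (∃ s : Fin N, s ≠ i0 ∧ s ≠ j0 ∧
      a = G • (ι k i0 * ι k s) ∧
      b = (G - Λ) • (ι k s * ι k i0) - xi • ι k s) ∨
  (∃ s : Fin N, s ≠ i0 ∧ s ≠ j0 ∧
      a = G • (ι k s * ι k j0) ∧
      b = (G - Λ) • (ι k j0 * ι k s) + xj • ι k s) ∨
  (∃ s l : Fin N, s ≠ i0 ∧ s ≠ j0 ∧ l ≠ i0 ∧ l ≠ j0 ∧
      a = ι k s * ι k l ∧ b = ι k l * ι k s)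

/-- The diffusion algebra `𝒟` of type `B`. -/
abbrev Diff := RingQuot (rel k N i0 j0 g Λ xi xj G)

/-- The images of the generators `D_i` in `𝒟`. -/
def D (i : Fin N) : Diff k N i0 j0 g Λ xi xj G :=
  RingQuot.mkAlgHom k (rel k N i0 j0 g Λ xi xj G) (ι k i)

/-- The defining property of the endomorphism `ν_{i0}` of `𝒟`. -/
def IsNuI (ν : Diff k N i0 j0 g Λ xi xj G →ₐ[k] Diff k N i0 j0 g Λ xi xj G) :
    Prop :=
  ν (D k N i0 j0 g Λ xi xj G i0) =
      g⁻¹ • ((g - Λ) • D k N i0 j0 g Λ xi xj G i0 - xi • 1) ∧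
  ν (D k N i0 j0 g Λ xi xj G j0) =
      (g - Λ)⁻¹ • (g • D k N i0 j0 g Λ xi xj G j0 - xj • 1) ∧
  ∀ s : Fin N, s ≠ i0 → s ≠ j0 →
    ν (D k N i0 j0 g Λ xi xj G s) =
      ((G - Λ)⁻¹ * G) • D k N i0 j0 g Λ xi xj G s

/-- The defining property of the endomorphism `ν_{j0}` of `𝒟`. -/
def IsNuJ (ν : Diff k N i0 j0 g Λ xi xj G →ₐ[k] Diff k N i0 j0 g Λ xi xj G) :
    Prop :=
  ν (D k N i0 j0 g Λ xi xj G i0) =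
      g⁻¹ • ((g - Λ) • D k N i0 j0 g Λ xi xj G i0 - xi • 1) ∧
  ν (D k N i0 j0 g Λ xi xj G j0) =
      g⁻¹ • ((g - Λ) • D k N i0 j0 g Λ xi xj G j0 - xj • 1) ∧
  ∀ s : Fin N, s ≠ i0 → s ≠ j0 →
    ν (D k N i0 j0 g Λ xi xj G s) =
      ((G - Λ)⁻¹ * G) • D k N i0 j0 g Λ xi xj G s

/-- The defining property of the endomorphism `ν_s` of `𝒟` (`s ∈ S`). -/
def IsNuS (s : Fin N)
    (ν : Diff k N i0 j0 g Λ xi xj G →ₐ[k] Diff k N i0 j0 g Λ xi xj G) : Prop :=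
  ν (D k N i0 j0 g Λ xi xj G i0) =
      G⁻¹ • ((G - Λ) • D k N i0 j0 g Λ xi xj G i0 - xi • 1) ∧
  ν (D k N i0 j0 g Λ xi xj G j0) =
      (G - Λ)⁻¹ • (G • D k N i0 j0 g Λ xi xj G j0 - xj • 1) ∧
  ∀ l : Fin N, l ≠ i0 → l ≠ j0 →
    ν (D k N i0 j0 g Λ xi xj G l) = D k N i0 j0 g Λ xi xj G l

/-- An algebra endomorphism that acts by invertible affine maps on a finite
generating family is bijective: it maps each of the finite-dimensional
filtration pieces `V ^ n` onto itself, where `V` is spanned by `1` and the generators. -/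
theorem bijective_of_affine {k A J : Type*} [Field k] [Ring A] [Algebra k A] [Finite J]
    (d : J → A) (hd : Algebra.adjoin k (Set.range d) = ⊤) (ν : A →ₐ[k] A)
    (h : ∀ i, ∃ c e : k, c ≠ 0 ∧ ν (d i) = c • d i + e • (1 : A)) :
    Function.Bijective ν := by
  set V : Submodule k A := Submodule.span k (insert 1 (Set.range d)) with hV
  have h1V : (1 : A) ∈ V := Submodule.subset_span (Set.mem_insert _ _)
  have hdV : ∀ i, d i ∈ V := fun i =>
    Submodule.subset_span (Set.mem_insert_of_mem _ ⟨i, rfl⟩)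
  have hfg : V.FG := Submodule.fg_span ((Set.finite_range d).insert 1)
  have hle : V ≤ V.map ν.toLinearMap := by
    rw [hV, Submodule.span_le, ← hV]
    rintro x (rfl | ⟨i, rfl⟩)
    · exact ⟨1, h1V, by simp⟩
    · obtain ⟨c, e, hc, hi⟩ := h i
      refine ⟨c⁻¹ • (d i - e • (1 : A)),
        V.smul_mem _ (V.sub_mem (hdV i) (V.smul_mem _ h1V)), ?_⟩
      simp [hi, smul_smul, hc]
  have hpow : ∀ n : ℕ, V ^ n ≤ (V ^ n).map ν.toLinearMap := by
    intro n
    rw [Submodule.map_pow]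
    exact pow_le_pow_left' hle n
  have hfgn : ∀ n : ℕ, (V ^ n).FG := fun n => hfg.pow n
  have hmono : Monotone fun n : ℕ => V ^ n := by
    have h1 : (1 : Submodule k A) ≤ V := by
      rw [Submodule.one_le]; exact h1V
    exact fun m n hmn => pow_le_pow_right' h1 hmn
  have hex : ∀ x : A, ∃ n : ℕ, x ∈ V ^ n := by
    intro x
    have hx : x ∈ Algebra.adjoin k (Set.range d) := by rw [hd]; trivial
    induction hx using Algebra.adjoin_induction with
    | mem x hx =>
      obtain ⟨i, rfl⟩ := hx
      exact ⟨1, by simpa using hdV i⟩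
    | algebraMap r => exact ⟨0, by rw [pow_zero]; exact Submodule.algebraMap_mem r⟩
    | add x y _ _ hx hy =>
      obtain ⟨m, hm⟩ := hx
      obtain ⟨n, hn⟩ := hy
      exact ⟨max m n, Submodule.add_mem _ (hmono (le_max_left m n) hm)
        (hmono (le_max_right m n) hn)⟩
    | mul x y _ _ hx hy =>
      obtain ⟨m, hm⟩ := hx
      obtain ⟨n, hn⟩ := hy
      exact ⟨m + n, by rw [pow_add]; exact Submodule.mul_mem_mul hm hn⟩
  constructor
  · rw [injective_iff_map_eq_zero]
    intro x hx
    obtain ⟨n, hn⟩ := hex x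
    have : FiniteDimensional k (V ^ n : Submodule k A) :=
      Module.Finite.iff_fg.mpr (hfgn n)
    have heq : V ^ n = (V ^ n).map ν.toLinearMap :=
      Submodule.eq_of_le_of_finrank_le (hpow n) (Submodule.finrank_map_le _ _)
    have hmaps : ∀ y ∈ V ^ n, ν.toLinearMap y ∈ V ^ n := by
      intro y hy
      rw [heq]
      exact Submodule.mem_map_of_mem hy
    have hsurj : Function.Surjective (ν.toLinearMap.restrict hmaps) := by
      rintro ⟨y, hy⟩
      obtain ⟨z, hz, hzy⟩ := hpow n hy
      exact ⟨⟨z, hz⟩, Subtype.ext hzy⟩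
    have hinj := LinearMap.injective_iff_surjective.mpr hsurj
    have h0 : (⟨x, hn⟩ : (V ^ n : Submodule k A)) = 0 := by
      apply hinj
      apply Subtype.ext
      simpa using hx
    exact congrArg Subtype.val h0
  · intro y
    obtain ⟨n, hn⟩ := hex y
    obtain ⟨z, _, hz⟩ := hpow n hn
    exact ⟨z, hz⟩

theorem adjoin_D : Algebra.adjoin k (Set.range (D k N i0 j0 g Λ xi xj G)) = ⊤ := by
  have hr : Set.range (D k N i0 j0 g Λ xi xj G) =
      Set.image (RingQuot.mkAlgHom k (rel k N i0 j0 g Λ xi xj G)) (Set.range (ι k)) := by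
    rw [← Set.range_comp]; rfl
  rw [hr, ← AlgHom.map_adjoin, FreeAlgebra.adjoin_range_ι, Algebra.map_top,
    AlgHom.range_eq_top]
  exact RingQuot.mkAlgHom_surjective k _

/-- Each of the endomorphisms `ν_{i0}`, `ν_{j0}`, and `ν_s`
(`s ∈ S`) of `𝒟` is bijective, i.e. a `k`-algebra automorphism of `𝒟`. -/
theorem nu_bijective (hN : 3 ≤ N) (hij : i0 < j0)
    (hg0 : g ≠ 0) (hgΛ : g ≠ Λ) (hG0 : G ≠ 0) (hGΛ : G ≠ Λ) :
    (∀ ν : Diff k N i0 j0 g Λ xi xj G →ₐ[k] Diff k N i0 j0 g Λ xi xj G,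
        IsNuI k N i0 j0 g Λ xi xj G ν → Function.Bijective ν) ∧
    (∀ ν : Diff k N i0 j0 g Λ xi xj G →ₐ[k] Diff k N i0 j0 g Λ xi xj G,
        IsNuJ k N i0 j0 g Λ xi xj G ν → Function.Bijective ν) ∧
    (∀ s : Fin N, s ≠ i0 → s ≠ j0 →
      ∀ ν : Diff k N i0 j0 g Λ xi xj G →ₐ[k] Diff k N i0 j0 g Λ xi xj G,
        IsNuS k N i0 j0 g Λ xi xj G s ν → Function.Bijective ν) := by
  have hg1 : g - Λ ≠ 0 := sub_ne_zero.mpr hgΛ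
  have hG1 : G - Λ ≠ 0 := sub_ne_zero.mpr hGΛ
  have key : ∀ (a b x : k) (y : Diff k N i0 j0 g Λ xi xj G),
      a⁻¹ • (b • y - x • (1 : Diff k N i0 j0 g Λ xi xj G)) =
        (a⁻¹ * b) • y + (-(a⁻¹ * x)) • (1 : Diff k N i0 j0 g Λ xi xj G) := by
    intro a b x y
    module
  refine ⟨?_, ?_, ?_⟩
  · rintro ν ⟨hi, hj, hs⟩
    refine bijective_of_affine _ (adjoin_D k N i0 j0 g Λ xi xj G) ν fun l => ?_
    by_cases h1 : l = i0
    · subst h1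
      exact ⟨_, _, mul_ne_zero (inv_ne_zero hg0) hg1, hi.trans (key _ _ _ _)⟩
    by_cases h2 : l = j0
    · subst h2
      exact ⟨_, _, mul_ne_zero (inv_ne_zero hg1) hg0, hj.trans (key _ _ _ _)⟩
    exact ⟨_, 0, mul_ne_zero (inv_ne_zero hG1) hG0, by rw [hs l h1 h2, zero_smul, add_zero]⟩
  · rintro ν ⟨hi, hj, hs⟩
    refine bijective_of_affine _ (adjoin_D k N i0 j0 g Λ xi xj G) ν fun l => ?_
    by_cases h1 : l = i0
    · subst h1
      exact ⟨_, _, mul_ne_zero (inv_ne_zero hg0) hg1, hi.trans (key _ _ _ _)⟩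
    by_cases h2 : l = j0
    · subst h2
      exact ⟨_, _, mul_ne_zero (inv_ne_zero hg0) hg1, hj.trans (key _ _ _ _)⟩
    exact ⟨_, 0, mul_ne_zero (inv_ne_zero hG1) hG0, by rw [hs l h1 h2, zero_smul, add_zero]⟩
  · rintro s - - ν ⟨hi, hj, hs⟩
    refine bijective_of_affine _ (adjoin_D k N i0 j0 g Λ xi xj G) ν fun l => ?_
    by_cases h1 : l = i0
    · subst h1
      exact ⟨_, _, mul_ne_zero (inv_ne_zero hG0) hG1, hi.trans (key _ _ _ _)⟩
    by_cases h2 : l = j0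
    · subst h2
      exact ⟨_, _, mul_ne_zero (inv_ne_zero hG1) hG0, hj.trans (key _ _ _ _)⟩
    exact ⟨1, 0, one_ne_zero, by rw [hs l h1 h2, zero_smul, add_zero, one_smul]⟩

end DiffusionB
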